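/- arXiv:2108.04988 — 3 statements merged into one kernel-verified Lean document; each statement's English description precedes it below -/
import Mathlib

section
/- Every nonempty string s over a linearly ordered alphabet admits a Lyndon factorization: there exists a finite sequence of Lyndon words w_1, w_2, ..., w_k such that s = w_1 · w_2 ··· w_k and w_1 ≥ w_2 ≥ ... ≥ w_k in the lexicographic order. -/
/-- `u ≤ v` in the lexicographic order induced by the strict order `r` on symbols:
either `u` is lexicographically smaller than `v`, or `u = v`. -/
def LexLe {α : Type*} (r : α → α → Prop) (u v : List α) : Prop :=
  List.Lex r u v ∨ u = v

/-- A Lyndon word w.r.t. the strict order `r`: a nonempty string that is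
lexicographically strictly smaller than all of its nonempty proper suffixes. -/
def IsLyndonRel {α : Type*} (r : α → α → Prop) (w : List α) : Prop :=
  w ≠ [] ∧ ∀ t : List α, t ≠ [] → t ≠ w → t <:+ w → List.Lex r w t

/-- A Lyndon factorization of `s`: a sequence of Lyndon words `w₁, …, w_k`
with `s = w₁ ⋯ w_k` and `w₁ ≥ w₂ ≥ ⋯ ≥ w_k` lexicographically. -/
def IsLyndonFactorizationRel {α : Type*} (r : α → α → Prop)
    (ws : List (List α)) (s : List α) : Prop :=
  (∀ w ∈ ws, IsLyndonRel r w) ∧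
  ws.Chain' (fun u v => LexLe r v u) ∧
  ws.flatten = s

/-- If `u` is lexicographically smaller than `v`, then either `u` is a proper prefix of `v`, or the
two strings differ at some position, so that extending them preserves the comparison. -/
theorem List.Lex.proper_prefix_or_append {α : Type*} {r : α → α → Prop} {u v : List α}
    (h : List.Lex r u v) :
    (∃ t, t ≠ [] ∧ v = u ++ t) ∨ ∀ x y, List.Lex r (u ++ x) (v ++ y) := by
  induction h with
  | nil => exact Or.inl ⟨_, List.cons_ne_nil _ _, rfl⟩
  | rel h => exact Or.inr fun _ _ => List.Lex.rel h
  | cons _ ih =>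
    rcases ih with ⟨t, ht, rfl⟩ | ih
    · exact Or.inl ⟨t, ht, rfl⟩
    · exact Or.inr fun x y => List.Lex.cons (ih x y)

theorem isLyndonRel_singleton {α : Type*} (r : α → α → Prop) (a : α) : IsLyndonRel r [a] := by
  refine ⟨List.cons_ne_nil _ _, fun t ht hta hsuf => ?_⟩
  rcases List.suffix_cons_iff.1 hsuf with h | h
  · exact absurd h hta
  · exact absurd (List.suffix_nil.1 h) ht

/-- The concatenation of two Lyndon words `u < v` precedes `v`. -/
theorem IsLyndonRel.append_lex_right {α : Type*} {r : α → α → Prop} {u v : List α}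
    (hu : u ≠ []) (hv : IsLyndonRel r v) (huv : List.Lex r u v) : List.Lex r (u ++ v) v := by
  rcases huv.proper_prefix_or_append with ⟨t, ht, htv⟩ | h
  · have hne : t ≠ v := by
      rintro rfl
      exact hu (List.self_eq_append_left.1 htv)
    have hlt := List.Lex.append_left r (hv.2 t ht hne ⟨u, htv.symm⟩) u
    rwa [← htv] at hlt
  · simpa using h v []

theorem IsLyndonRel.append {α : Type*} [LinearOrder α] {u v : List α}
    (hu : IsLyndonRel (· < ·) u) (hv : IsLyndonRel (· < ·) v) (huv : List.Lex (· < ·) u v) :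
    IsLyndonRel (· < ·) (u ++ v) := by
  have huvv : u ++ v < v := hv.append_lex_right hu.1 huv
  refine ⟨by simp [hu.1], fun t ht hne hsuf => ?_⟩
  obtain ⟨p, hp⟩ := hsuf
  rcases List.append_eq_append_iff.1 hp with ⟨u', hu', rfl⟩ | ⟨q, -, hq⟩
  · rcases eq_or_ne u' [] with rfl | hnil
    · exact huvv
    · have hne' : u' ≠ u := fun h => hne (by rw [h])
      have hsuf : u' <:+ u := ⟨p, hu'.symm⟩
      rcases (hu.2 u' hnil hne' hsuf).proper_prefix_or_append with ⟨x, hx, hux⟩ | h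
      · have hlen := hsuf.length_le
        have hpos := List.length_pos_iff.2 hx
        rw [hux, List.length_append] at hlen
        omega
      · exact h v v
  · rcases eq_or_ne t v with rfl | htv
    · exact huvv
    · have hvt : v < t := hv.2 t ht htv ⟨q, hq.symm⟩
      exact lt_trans huvv hvt

/-- A Lyndon word can be prepended to a string that has a Lyndon factorization. -/
theorem IsLyndonFactorizationRel.exists_append {α : Type*} [LinearOrder α]
    {ws : List (List α)} {s w : List α} (hws : IsLyndonFactorizationRel (· < ·) ws s)
    (hw : IsLyndonRel (· < ·) w) :
    ∃ ws' : List (List α), ws' ≠ [] ∧ IsLyndonFactorizationRel (· < ·) ws' (w ++ s) := by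
  induction ws generalizing w s with
  | nil =>
    obtain ⟨-, -, rfl⟩ := hws
    exact ⟨[w], by simp, by simpa using hw, List.isChain_singleton _, by simp⟩
  | cons v vs ih =>
    obtain ⟨hl, hc, rfl⟩ := hws
    rcases lt_or_ge w v with h | h
    · have hvs : IsLyndonFactorizationRel (· < ·) vs vs.flatten :=
        ⟨fun x hx => hl x (List.mem_cons_of_mem _ hx), hc.tail, rfl⟩
      simpa using ih hvs (hw.append (hl v List.mem_cons_self) h)
    · refine ⟨w :: v :: vs, by simp, ?_, List.isChain_cons_cons.2 ⟨?_, hc⟩, by simp⟩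
      · exact List.forall_mem_cons.2 ⟨hw, hl⟩
      · exact h.lt_or_eq

/-- Every nonempty string over a linearly ordered alphabet admits a
Lyndon factorization. -/
theorem lyndon_factorization_exists {α : Type*} [LinearOrder α]
    (s : List α) (hs : s ≠ []) :
    ∃ ws : List (List α), ws ≠ [] ∧
      IsLyndonFactorizationRel (· < ·) ws s := by
  induction s with
  | nil => exact absurd rfl hs
  | cons a s ih =>
    rcases eq_or_ne s [] with rfl | hne
    · exact ⟨[[a]], by simp, by simpa using isLyndonRel_singleton _ a,
        List.isChain_singleton _, rfl⟩
    · obtain ⟨ws, -, hws⟩ := ih hne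
      exact hws.exists_append (isLyndonRel_singleton _ a)
end

section
/- The Lyndon factorization is unique: if w_1, ..., w_k and v_1, ..., v_m are two sequences of Lyndon words, each lexicographically nonincreasing, whose concatenations both equal the same string s, then k = m and w_i = v_i for all i. -/
theorem lexLe_iff_le {α : Type*} [LinearOrder α] {u v : List α} :
    LexLe (· < ·) u v ↔ u ≤ v := by
  rw [le_iff_lt_or_eq]
  rfl

theorem le_of_isPrefix {α : Type*} [LinearOrder α] {u v : List α} (h : u <+: v) : u ≤ v := by
  obtain ⟨t, rfl⟩ := h
  induction u with
  | nil => exact not_lt.1 fun h => by cases h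
  | cons a u ih => exact List.cons_le_cons a ih

/-- A nonempty prefix of a concatenation has a nonempty suffix that is a prefix of one of the
factors. -/
theorem exists_suffix_prefix_of_prefix_flatten {α : Type*} {ws : List (List α)} {u : List α}
    (hu : u ≠ []) (h : u <+: ws.flatten) :
    ∃ w ∈ ws, ∃ p : List α, p ≠ [] ∧ p <:+ u ∧ p <+: w := by
  induction ws generalizing u with
  | nil => exact absurd (List.prefix_nil.1 h) hu
  | cons w ws ih =>
    rw [List.flatten_cons] at h
    rcases List.prefix_or_prefix_of_prefix h (List.prefix_append w ws.flatten) with h' | ⟨u', rfl⟩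
    · exact ⟨w, by simp, u, hu, List.suffix_rfl, h'⟩
    · by_cases hu' : u' = []
      · subst hu'
        exact ⟨w, by simp, w, by simpa using hu, by simp, List.prefix_rfl⟩
      · obtain ⟨x, hx, p, hp, hpu, hpx⟩ := ih hu' ((List.prefix_append_right_inj w).1 h)
        exact ⟨x, by simp [hx], p, hp, hpu.trans (List.suffix_append w u'), hpx⟩

/-- A Lyndon prefix of `s` that extends the first factor of a Lyndon factorization of `s` equals
that factor. -/
theorem IsLyndonRel.eq_of_prefix {α : Type*} [LinearOrder α] {v w : List α} {ws : List (List α)}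
    {s : List α} (hv : IsLyndonRel (· < ·) v)
    (hw : IsLyndonFactorizationRel (· < ·) (w :: ws) s) (hvs : v <+: s) (hwv : w <+: v) :
    w = v := by
  obtain ⟨hL, hc, rfl⟩ := hw
  obtain ⟨x, rfl⟩ := hwv
  by_contra hne
  have hx : x ≠ [] := fun h => hne (by simp [h])
  rw [List.flatten_cons, List.prefix_append_right_inj] at hvs
  obtain ⟨y, hy, p, hp, hpx, hpy⟩ := exists_suffix_prefix_of_prefix_flatten hx hvs
  have hwne : 0 < w.length := List.length_pos_iff.2 (hL w (by simp)).1
  have hyw : y ≤ w := by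
    have hc' : (w :: ws).IsChain (· ≥ ·) := hc.imp fun _ _ => lexLe_iff_le.1
    exact (List.pairwise_cons.1 (List.isChain_iff_pairwise.1 hc')).1 y hy
  have hlt : w ++ x < p := hv.2 p hp
    (fun h => by have := hpx.length_le; simp [h] at this; simp [this] at hwne)
    (hpx.trans (List.suffix_append w x))
  exact absurd hlt (not_lt.2
    ((le_of_isPrefix hpy).trans (hyw.trans (le_of_isPrefix (List.prefix_append w x)))))

theorem IsLyndonFactorizationRel.tail {α : Type*} {r : α → α → Prop} {w : List α}
    {ws : List (List α)} {s : List α} (h : IsLyndonFactorizationRel r (w :: ws) s) :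
    IsLyndonFactorizationRel r ws ws.flatten :=
  ⟨fun u hu => h.1 u (List.mem_cons_of_mem w hu), List.IsChain.tail h.2.1, rfl⟩

theorem IsLyndonFactorizationRel.eq_nil {α : Type*} {r : α → α → Prop}
    {ws : List (List α)} (h : IsLyndonFactorizationRel r ws []) : ws = [] :=
  List.eq_nil_iff_forall_not_mem.2 fun w hw =>
    (h.1 w hw).1 (List.flatten_eq_nil_iff.1 h.2.2 w hw)

/-- The Lyndon factorization is unique: two lexicographically nonincreasing
sequences of Lyndon words with the same concatenation are equal (hence have the
same number of factors and the same factors). -/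
theorem lyndon_factorization_unique {α : Type*} [LinearOrder α]
    (s : List α) (ws vs : List (List α))
    (hw : IsLyndonFactorizationRel (· < ·) ws s)
    (hv : IsLyndonFactorizationRel (· < ·) vs s) :
    ws = vs := by
  induction ws generalizing s vs with
  | nil =>
    obtain rfl : [] = s := hw.2.2
    exact hv.eq_nil.symm
  | cons w ws ih =>
    cases vs with
    | nil =>
      obtain rfl : [] = s := hv.2.2
      exact hw.eq_nil
    | cons v vs =>
      have hws : w <+: s := ⟨ws.flatten, hw.2.2⟩
      have hvs : v <+: s := ⟨vs.flatten, hv.2.2⟩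
      obtain rfl : w = v := by
        rcases List.prefix_or_prefix_of_prefix hws hvs with h | h
        · exact (hv.1 v (by simp)).eq_of_prefix hw hvs h
        · exact ((hw.1 w (by simp)).eq_of_prefix hv hws h).symm
      have hflat : ws.flatten = vs.flatten :=
        List.append_cancel_left (hw.2.2.trans hv.2.2.symm)
      rw [ih ws.flatten vs hw.tail (hflat ▸ hv.tail)]
end

section
/- A nonempty primitive string s over a linearly ordered alphabet is lexicographically strictly smaller than all of its nonempty proper suffixes if and only if s is lexicographically strictly smaller than all of its conjugates (circular rotations) other than s itself. -/
/-- A string is primitive if it is not a `k`-fold repetition of a string for `k > 1`. -/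
def IsPrimitive {α : Type*} (u : List α) : Prop :=
  ¬ ∃ (v : List α) (k : ℕ), 1 < k ∧ u = (List.replicate k v).flatten

theorem exists_replicate_flatten_of_append_comm {α : Type*} (u t : List α)
    (h : u ++ t = t ++ u) :
    ∃ (z : List α) (a b : ℕ),
      u = (List.replicate a z).flatten ∧ t = (List.replicate b z).flatten := by
  induction hn : u.length + t.length using Nat.strong_induction_on generalizing u t with
  | _ n ih =>
    subst hn
    rcases eq_or_ne u [] with rfl | hu
    · exact ⟨t, 0, 1, by simp, by simp⟩
    rcases eq_or_ne t [] with rfl | ht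
    · exact ⟨u, 1, 0, by simp, by simp⟩
    have hu' := List.length_pos_of_ne_nil hu
    have ht' := List.length_pos_of_ne_nil ht
    rcases List.append_eq_append_iff.1 h with ⟨c, rfl, -⟩ | ⟨c, rfl, -⟩
    · obtain ⟨z, a, b, hz, hc⟩ := ih (u.length + c.length) (by simp; omega) u c
        (by simpa using h) rfl
      exact ⟨z, a, a + b, hz, by
        rw [List.replicate_add, List.flatten_append, ← hz, ← hc]⟩
    · obtain ⟨z, a, b, hz, hc⟩ := ih (t.length + c.length) (by simp; omega) t c
        (by simpa using h.symm) rfl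
      exact ⟨z, a + b, a, by
        rw [List.replicate_add, List.flatten_append, ← hz, ← hc], hz⟩

theorem IsPrimitive.append_ne_append_comm {α : Type*} {u t : List α}
    (h : IsPrimitive (u ++ t)) (hu : u ≠ []) (ht : t ≠ []) : u ++ t ≠ t ++ u := by
  intro hc
  obtain ⟨z, a, b, rfl, rfl⟩ := exists_replicate_flatten_of_append_comm u t hc
  have ha : a ≠ 0 := by rintro rfl; simp at hu
  have hb : b ≠ 0 := by rintro rfl; simp at ht
  exact h ⟨z, a + b, by omega, by rw [List.replicate_add, List.flatten_append]⟩

theorem List.Lex.prefix_or_append {α : Type*} {r : α → α → Prop} {s t : List α}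
    (h : List.Lex r s t) : s <+: t ∨ ∀ x y, List.Lex r (s ++ x) (t ++ y) := by
  induction h with
  | nil => exact Or.inl List.nil_prefix
  | cons _ ih =>
    rcases ih with ih | ih
    · exact Or.inl (by simpa using ih)
    · exact Or.inr fun x y => .cons (ih x y)
  | rel h => exact Or.inr fun _ _ => .rel h

theorem List.Lex.append_of_length_eq {α : Type*} [LinearOrder α] {s t : List α}
    (h : List.Lex (· < ·) s t) (hl : s.length = t.length) (x y : List α) :
    List.Lex (· < ·) (s ++ x) (t ++ y) := by
  rcases h.prefix_or_append with hp | hp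
  · exact absurd (show s < t from h) (by rw [hp.eq_of_length hl]; exact lt_irrefl t)
  · exact hp x y

theorem List.lex_of_append_left {α : Type*} [LinearOrder α] {p s t : List α}
    (h : List.Lex (· < ·) (p ++ s) (p ++ t)) : List.Lex (· < ·) s t := by
  induction p with
  | nil => exact h
  | cons a p ih =>
    cases h with
    | cons h => exact ih h
    | rel h => exact absurd h (lt_irrefl a)

/-- A nonempty primitive string is lexicographically strictly smaller than all of its
nonempty proper suffixes iff it is lexicographically strictly smaller than all of its
conjugates (circular rotations) other than itself. -/
theorem lyndon_iff_smallest_conjugate {α : Type*} [LinearOrder α]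
    (s : List α) (hs : s ≠ []) (hprim : IsPrimitive s) :
    (∀ t : List α, t ≠ [] → t ≠ s → t <:+ s → List.Lex (· < ·) s t) ↔
    (∀ i : ℕ, s.rotate i ≠ s → List.Lex (· < ·) s (s.rotate i)) := by
  constructor
  · intro h i hi
    have hlt : i % s.length < s.length := Nat.mod_lt _ (List.length_pos_of_ne_nil hs)
    rw [List.rotate_eq_drop_append_take_mod] at hi ⊢
    refine (h (s.drop (i % s.length)) ?_ ?_ (List.drop_suffix _ _)).append_right _ _
    · simpa using hlt
    · intro he
      have hz : i % s.length = 0 := by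
        have := congrArg List.length he
        rw [List.length_drop] at this
        omega
      simp [hz] at hi
  · rintro h t ht hts ⟨u, rfl⟩
    have hu : u ≠ [] := by rintro rfl; simp at hts
    have hrot : List.Lex (· < ·) (u ++ t) (t ++ u) := by
      have hr := h u.length
      rw [List.rotate_append_length_eq] at hr
      exact hr (hprim.append_ne_append_comm hu ht).symm
    rcases lt_trichotomy (u ++ t) t with hlt | heq | hgt
    · exact hlt
    · exact absurd heq.symm hts
    exfalso
    rcases List.Lex.prefix_or_append hgt with ⟨w, hw⟩ | hp
    · have hlen : w.length = u.length := by
        have := congrArg List.length hw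
        simp only [List.length_append] at this
        omega
      have hwu : List.Lex (· < ·) w u := List.lex_of_append_left (by rwa [← hw] at hrot)
      have hwt : w ++ t < u ++ t := hwu.append_of_length_eq hlen t t
      have hr := h t.length
      rw [← hw, List.rotate_append_length_eq, hw] at hr
      exact lt_asymm hwt (hr hwt.ne)
    · have htu : t ++ u < u ++ t := by simpa using hp u []
      exact lt_asymm htu hrot
end
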